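/- Let B, J be real numbers with B > 2J > 0 and let H be the 8×8 Hermitian matrix on (ℂ²)⊗(ℂ²)⊗(ℂ²) given by H = (B/2)(σ_z⊗I⊗I + I⊗σ_z⊗I + I⊗I⊗σ_z) + J(σ_x⊗σ_x⊗I + σ_y⊗σ_y⊗I + I⊗σ_x⊗σ_x + I⊗σ_y⊗σ_y + σ_x⊗I⊗σ_x + σ_y⊗I⊗σ_y). Then the product vector |111⟩ = e₁⊗e₁⊗e₁ (where σ_z e₁ = −e₁) is an eigenvector of H with eigenvalue −3B/2, and −3B/2 is the unique smallest eigenvalue of H: every eigenvalue of H other than −3B/2 is strictly greater than −3B/2, and the eigenspace for −3B/2 is one-dimensional, spanned by |111⟩. -/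

import Mathlib

open scoped Matrix Kronecker
open Module

/-- The Pauli matrix `σ_x`. -/
noncomputable def σx : Matrix (Fin 2) (Fin 2) ℂ := !![0, 1; 1, 0]
/-- The Pauli matrix `σ_y`. -/
noncomputable def σy : Matrix (Fin 2) (Fin 2) ℂ := !![0, -Complex.I; Complex.I, 0]
/-- The Pauli matrix `σ_z`. -/
noncomputable def σz : Matrix (Fin 2) (Fin 2) ℂ := !![1, 0; 0, -1]

/-- The Hamiltonian of the isotropic XX model of three qubits on a ring in a constant
magnetic field `B` with coupling `J`:
`H = (B/2) ∑ᵢ σᵢᶻ + J ∑ᵢ (σᵢˣ σᵢ₊₁ˣ + σᵢʸ σᵢ₊₁ʸ)` with periodic boundary conditions. -/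
noncomputable def XXHamiltonian (B J : ℝ) :
    Matrix (Fin 2 × Fin 2 × Fin 2) (Fin 2 × Fin 2 × Fin 2) ℂ :=
  ((B / 2 : ℝ) : ℂ) • (σz ⊗ₖ (1 ⊗ₖ 1) + 1 ⊗ₖ (σz ⊗ₖ 1) + 1 ⊗ₖ (1 ⊗ₖ σz)) +
  (J : ℂ) • (σx ⊗ₖ (σx ⊗ₖ 1) + σy ⊗ₖ (σy ⊗ₖ 1) + 1 ⊗ₖ (σx ⊗ₖ σx) + 1 ⊗ₖ (σy ⊗ₖ σy) +
    σx ⊗ₖ (1 ⊗ₖ σx) + σy ⊗ₖ (1 ⊗ₖ σy))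

/-- The product vector `|111⟩ = e₁ ⊗ e₁ ⊗ e₁`, where `e₁` is the eigenvector of `σ_z` with
eigenvalue `−1`. -/
noncomputable def ket111 : Fin 2 × Fin 2 × Fin 2 → ℂ :=
  fun p => if p = (1, 1, 1) then 1 else 0

/-- The symmetric three-site hopping matrix with diagonal `a` and off-diagonal `t` has only the
eigenvalues `a + 2 * t` and `a - t`. -/
theorem triangle_hopping_eq_zero {K : Type*} [Field K] {a t μ x y z : K}
    (hx : a * x + t * (y + z) = μ * x) (hy : a * y + t * (x + z) = μ * y)
    (hz : a * z + t * (x + y) = μ * z) (h₁ : μ ≠ a + 2 * t) (h₂ : μ ≠ a - t) :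
    x = 0 ∧ y = 0 ∧ z = 0 := by
  have hsum : x + y + z = 0 := by
    refine (mul_eq_zero.mp ?_).resolve_left (sub_ne_zero.mpr h₁)
    linear_combination -hx - hy - hz
  refine ⟨?_, ?_, ?_⟩ <;> refine (mul_eq_zero.mp ?_).resolve_left (sub_ne_zero.mpr h₂)
  · linear_combination -hx + t * hsum
  · linear_combination -hy + t * hsum
  · linear_combination -hz + t * hsum

/-- The action of the XX Hamiltonian in the computational basis. -/
theorem XXHamiltonian_mulVec (B J : ℝ) (v : Fin 2 × Fin 2 × Fin 2 → ℂ) :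
    (XXHamiltonian B J *ᵥ v) (0, 0, 0) = 3 * B / 2 * v (0, 0, 0) ∧
    (XXHamiltonian B J *ᵥ v) (0, 0, 1) =
      B / 2 * v (0, 0, 1) + 2 * J * (v (0, 1, 0) + v (1, 0, 0)) ∧
    (XXHamiltonian B J *ᵥ v) (0, 1, 0) =
      B / 2 * v (0, 1, 0) + 2 * J * (v (0, 0, 1) + v (1, 0, 0)) ∧
    (XXHamiltonian B J *ᵥ v) (1, 0, 0) =
      B / 2 * v (1, 0, 0) + 2 * J * (v (0, 0, 1) + v (0, 1, 0)) ∧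
    (XXHamiltonian B J *ᵥ v) (1, 1, 0) =
      -B / 2 * v (1, 1, 0) + 2 * J * (v (1, 0, 1) + v (0, 1, 1)) ∧
    (XXHamiltonian B J *ᵥ v) (1, 0, 1) =
      -B / 2 * v (1, 0, 1) + 2 * J * (v (1, 1, 0) + v (0, 1, 1)) ∧
    (XXHamiltonian B J *ᵥ v) (0, 1, 1) =
      -B / 2 * v (0, 1, 1) + 2 * J * (v (1, 1, 0) + v (1, 0, 1)) ∧
    (XXHamiltonian B J *ᵥ v) (1, 1, 1) = -(3 * B / 2) * v (1, 1, 1) := by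
  refine ⟨?_, ?_, ?_, ?_, ?_, ?_, ?_, ?_⟩ <;>
  · simp [XXHamiltonian, Matrix.mulVec, dotProduct, Fintype.sum_prod_type, Fin.sum_univ_two,
      σx, σy, σz, Matrix.one_apply, -mul_eq_mul_right_iff]
    ring

theorem XXHamiltonian_mulVec_ket111 (B J : ℝ) :
    XXHamiltonian B J *ᵥ ket111 = ((-(3 * B / 2) : ℝ) : ℂ) • ket111 := by
  obtain ⟨h₁, h₂, h₃, h₄, h₅, h₆, h₇, h₈⟩ := XXHamiltonian_mulVec B J ket111
  ext ⟨i, j, k⟩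
  fin_cases i <;> fin_cases j <;> fin_cases k <;> simp_all [ket111]

/-- An eigenvector of the XX Hamiltonian is a multiple of `|111⟩`, unless its eigenvalue is one of
the remaining five. -/
theorem XXHamiltonian_eigenvector_cases {B J : ℝ} {μ : ℂ} {v : Fin 2 × Fin 2 × Fin 2 → ℂ}
    (hv : XXHamiltonian B J *ᵥ v = μ • v) :
    (∃ r ∈ ({3 * B / 2, B / 2 + 4 * J, B / 2 - 2 * J, -B / 2 + 4 * J, -B / 2 - 2 * J} : Set ℝ),
      μ = r) ∨ v = v (1, 1, 1) • ket111 := by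
  refine or_iff_not_imp_left.mpr fun hμ => ?_
  simp only [Set.mem_insert_iff, Set.mem_singleton_iff, exists_eq_or_imp, exists_eq_left,
    not_or] at hμ
  push_cast at hμ
  obtain ⟨hμ₁, hμ₂, hμ₃, hμ₄, hμ₅⟩ := hμ
  obtain ⟨h₁, h₂, h₃, h₄, h₅, h₆, h₇, -⟩ := XXHamiltonian_mulVec B J v
  simp only [hv, Pi.smul_apply, smul_eq_mul] at h₁ h₂ h₃ h₄ h₅ h₆ h₇
  have e : v (0, 0, 0) = 0 := by
    refine (mul_eq_zero.mp ?_).resolve_left (sub_ne_zero.mpr hμ₁)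
    linear_combination h₁
  have four : (2 : ℂ) * (2 * J) = 4 * J := by ring
  obtain ⟨e₁, e₂, e₃⟩ := triangle_hopping_eq_zero h₂.symm h₃.symm h₄.symm
    (by rwa [four]) hμ₃
  obtain ⟨e₄, e₅, e₆⟩ := triangle_hopping_eq_zero h₅.symm h₆.symm h₇.symm
    (by rwa [four]) hμ₅
  ext ⟨i, j, k⟩
  fin_cases i <;> fin_cases j <;> fin_cases k <;>
    simp [ket111, e, e₁, e₂, e₃, e₄, e₅, e₆]

/-- For `B > 2J > 0`, the product vector `|111⟩` is an eigenvector of the three-qubit XX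
Hamiltonian with eigenvalue `−3B/2`, this is the unique smallest eigenvalue (every other
eigenvalue is real and strictly greater), and its eigenspace is one-dimensional, spanned
by `|111⟩`. -/
theorem XXHamiltonian_ground_state_of_large_field (B J : ℝ) (hJ : 0 < J) (hB : 2 * J < B) :
    (XXHamiltonian B J) *ᵥ ket111 = ((-(3 * B / 2) : ℝ) : ℂ) • ket111 ∧
    (∀ μ : ℂ, Module.End.HasEigenvalue (XXHamiltonian B J).mulVecLin μ →
      μ = ((-(3 * B / 2) : ℝ) : ℂ) ∨ (-(3 * B / 2) < μ.re ∧ μ.im = 0)) ∧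
    Module.End.eigenspace (XXHamiltonian B J).mulVecLin ((-(3 * B / 2) : ℝ) : ℂ) =
      Submodule.span ℂ {ket111} := by
  have hlt : ∀ r ∈ ({3 * B / 2, B / 2 + 4 * J, B / 2 - 2 * J, -B / 2 + 4 * J,
      -B / 2 - 2 * J} : Set ℝ), -(3 * B / 2) < r := by
    rintro r (rfl | rfl | rfl | rfl | rfl) <;> linarith
  refine ⟨XXHamiltonian_mulVec_ket111 B J, fun μ hμ => ?_, le_antisymm (fun v hv => ?_) ?_⟩
  · obtain ⟨v, hv⟩ := hμ.exists_hasEigenvector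
    have hHv : XXHamiltonian B J *ᵥ v = μ • v := hv.apply_eq_smul
    obtain ⟨r, hr, rfl⟩ | h := XXHamiltonian_eigenvector_cases hHv
    · exact Or.inr ⟨by simpa using hlt r hr, Complex.ofReal_im r⟩
    · left
      refine smul_left_injective ℂ hv.2 ?_
      change μ • v = _ • v
      rw [← hHv, h, Matrix.mulVec_smul, XXHamiltonian_mulVec_ket111, smul_comm]
  · obtain ⟨r, hr, h⟩ | h :=
      XXHamiltonian_eigenvector_cases (Module.End.mem_eigenspace_iff.mp hv)
    · exact absurd (Complex.ofReal_injective h) (hlt r hr).ne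
    · exact Submodule.mem_span_singleton.mpr ⟨_, h.symm⟩
  · rw [Submodule.span_singleton_le_iff_mem, Module.End.mem_eigenspace_iff]
    exact XXHamiltonian_mulVec_ket111 B J
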